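/- Let t ≥ 0 be fixed and let f, g ∈ L¹(ℝ³). Then (1/p⁰)Q⁻(f,g) ∈ L¹(ℝ³) and ‖(1/p⁰)Q⁻(f,g)‖ ≤ C‖f‖‖g‖, where C = 8πC₁a(0)⁶/C₀³. -/

import Mathlib

open MeasureTheory Real Metric

noncomputable section

namespace RelBoltz

/-- Momentum space `ℝ³`. -/
abbrev E3 := EuclideanSpace ℝ (Fin 3)

/-- The weighted dot product `p̄·q̄ = a²(p¹q¹+p²q²+p³q³)`, `α` being the value `a(t)`
of the cosmological expansion factor. -/
def dotp (α : ℝ) (p q : E3) : ℝ := α ^ 2 * ∑ i, p i * q i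

/-- `p⁰ = √(1+|p̄|²)`. -/
def p0 (α : ℝ) (p : E3) : ℝ := Real.sqrt (1 + dotp α p p)

/-- The energy `e = p⁰ + q⁰`. -/
def ener (α : ℝ) (p q : E3) : ℝ := p0 α p + p0 α q

/-- The collision function `b(p̄,q̄,ω)`. -/
def bcol (α : ℝ) (p q ω : E3) : ℝ :=
  2 * p0 α p * p0 α q * ener α p q * dotp α ω ((p0 α q)⁻¹ • q - (p0 α p)⁻¹ • p) /
    (ener α p q ^ 2 - dotp α ω (p + q) ^ 2)

/-- Post-collisional momentum `p̄′ = p̄ + b ω`. -/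
def pPr (α : ℝ) (p q ω : E3) : E3 := p + bcol α p q ω • ω

/-- Post-collisional momentum `q̄′ = q̄ - b ω`. -/
def qPr (α : ℝ) (p q ω : E3) : E3 := q - bcol α p q ω • ω

/-- The surface measure on the unit sphere `S² ⊆ ℝ³` (total mass `4π`). -/
def sphMeasure : Measure (sphere (0 : E3) 1) := (volume : Measure E3).toSphere

/-- The gain term `Q⁺(f,g)`. -/
def Qplus (α : ℝ) (k : E3 → E3 → E3 → E3 → ℝ) (f g : E3 → ℝ) : E3 → ℝ := fun p =>
  ∫ q : E3, (α ^ 3 / p0 α q) *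
    ∫ ω : sphere (0 : E3) 1,
      f (pPr α p q ω) * g (qPr α p q ω) * k p q (pPr α p q ω) (qPr α p q ω) ∂sphMeasure

/-- The loss term `Q⁻(f,g)`. -/
def Qminus (α : ℝ) (k : E3 → E3 → E3 → E3 → ℝ) (f g : E3 → ℝ) : E3 → ℝ := fun p =>
  ∫ q : E3, (α ^ 3 / p0 α q) *
    ∫ ω : sphere (0 : E3) 1,
      f p * g q * k p q (pPr α p q ω) (qPr α p q ω) ∂sphMeasure

/-- The collision operator `Q = Q⁺ - Q⁻`. -/
def Qcol (α : ℝ) (k : E3 → E3 → E3 → E3 → ℝ) (f g : E3 → ℝ) : E3 → ℝ := fun p =>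
  Qplus α k f g p - Qminus α k f g p

/-- `(1/p⁰) Q(f,g)`. -/
def QovP (α : ℝ) (k : E3 → E3 → E3 → E3 → ℝ) (f g : E3 → ℝ) : E3 → ℝ := fun p =>
  Qcol α k f g p / p0 α p

/-- The weighted L¹ norm `‖h‖ = (a(t)⁶/a(0)⁶) ∫ |h(p̄)| dp̄`, where `a0 = a(0)`, `α = a(t)`. -/
def wnorm (a0 α : ℝ) (h : E3 → ℝ) : ℝ := (α ^ 6 / a0 ^ 6) * ∫ p : E3, |h p|

/-- The set `X_r = {f ∈ L¹(ℝ³) : f ≥ 0 a.e., ‖f‖ ≤ r}`. -/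
def memXr (a0 α r : ℝ) (f : E3 → ℝ) : Prop :=
  Integrable f ∧ (∀ᵐ p : E3, 0 ≤ f p) ∧ wnorm a0 α f ≤ r

/-- The constant `C = 8πC₁a(0)⁶/C₀³`. -/
def Cconst (C₀ C₁ a0 : ℝ) : ℝ := 8 * π * C₁ * a0 ^ 6 / C₀ ^ 3

end RelBoltz

open RelBoltz

namespace RelBoltz

lemma dotp_self_nonneg (α : ℝ) (p : E3) : 0 ≤ dotp α p p :=
  mul_nonneg (sq_nonneg α) (Finset.sum_nonneg fun i _ => mul_self_nonneg (p i))

lemma one_le_p0 (α : ℝ) (p : E3) : 1 ≤ p0 α p :=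
  Real.one_le_sqrt.2 (le_add_of_nonneg_right (dotp_self_nonneg α p))

lemma measurable_dotp {X : Type*} [MeasurableSpace X] (α : ℝ) {u v : X → E3}
    (hu : Measurable u) (hv : Measurable v) : Measurable fun x => dotp α (u x) (v x) := by
  unfold dotp
  fun_prop

lemma measurable_p0 {X : Type*} [MeasurableSpace X] (α : ℝ) {u : X → E3}
    (hu : Measurable u) : Measurable fun x => p0 α (u x) :=
  (measurable_const.add (measurable_dotp α hu hu)).sqrt

lemma measurable_bcol {X : Type*} [MeasurableSpace X] (α : ℝ) {u v w : X → E3}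
    (hu : Measurable u) (hv : Measurable v) (hw : Measurable w) :
    Measurable fun x => bcol α (u x) (v x) (w x) := by
  have hpu := measurable_p0 α hu
  have hpv := measurable_p0 α hv
  have h1 := measurable_dotp α hw ((hpv.inv.smul hv).sub (hpu.inv.smul hu))
  have h2 := measurable_dotp α hw (hu.add hv)
  exact ((((hpu.const_mul 2).mul hpv).mul (hpu.add hpv)).mul h1).div
    (((hpu.add hpv).pow_const 2).sub (h2.pow_const 2))

lemma sphMeasure_real_univ : sphMeasure.real Set.univ = 4 * π := by
  rw [sphMeasure, Measure.real, Measure.toSphere_apply_univ, EuclideanSpace.volume_ball_fin_three]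
  simp [ENNReal.toReal_ofReal (show (0 : ℝ) ≤ π * 4 / 3 by positivity), ← mul_div_assoc]
  ring

instance : IsFiniteMeasure sphMeasure :=
  inferInstanceAs (IsFiniteMeasure (volume : Measure E3).toSphere)

/-- The collision kernel averaged over the scattering angle. -/
def angularKernel (α : ℝ) (k : E3 → E3 → E3 → E3 → ℝ) (p q : E3) : ℝ :=
  ∫ ω : sphere (0 : E3) 1, k p q (pPr α p q ω) (qPr α p q ω) ∂sphMeasure

/-- The collision frequency, i.e. the factor multiplying `f p` in the loss term. -/
def collisionFreq (α : ℝ) (k : E3 → E3 → E3 → E3 → ℝ) (g : E3 → ℝ) (p : E3) : ℝ :=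
  ∫ q : E3, (α ^ 3 / p0 α q) * (g q * angularKernel α k p q)

lemma Qminus_eq_mul_collisionFreq (α : ℝ) (k : E3 → E3 → E3 → E3 → ℝ) (f g : E3 → ℝ) (p : E3) :
    Qminus α k f g p = f p * collisionFreq α k g p := by
  simp only [Qminus, collisionFreq, angularKernel, mul_assoc, integral_const_mul]
  rw [← integral_const_mul]
  congr 1 with q
  ring

lemma abs_angularKernel_le (α : ℝ) {k : E3 → E3 → E3 → E3 → ℝ} {M : ℝ}
    (hk : ∀ p q p' q', |k p q p' q'| ≤ M) (p q : E3) :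
    |angularKernel α k p q| ≤ 4 * π * M := by
  have h := norm_integral_le_of_norm_le_const (μ := sphMeasure)
    (f := fun ω : sphere (0 : E3) 1 => k p q (pPr α p q ω) (qPr α p q ω))
    (Filter.Eventually.of_forall fun ω => hk _ _ _ _)
  rw [sphMeasure_real_univ, mul_comm] at h
  exact h

lemma stronglyMeasurable_angularKernel (α : ℝ) {k : E3 → E3 → E3 → E3 → ℝ}
    (hk : Measurable fun x : E3 × E3 × E3 × E3 => k x.1 x.2.1 x.2.2.1 x.2.2.2) :
    StronglyMeasurable fun x : E3 × E3 => angularKernel α k x.1 x.2 := by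
  have hp : Measurable fun y : (E3 × E3) × sphere (0 : E3) 1 => y.1.1 := by fun_prop
  have hq : Measurable fun y : (E3 × E3) × sphere (0 : E3) 1 => y.1.2 := by fun_prop
  have hw : Measurable fun y : (E3 × E3) × sphere (0 : E3) 1 => (y.2 : E3) := by fun_prop
  have hb := (measurable_bcol α hp hq hw).smul hw
  exact (hk.comp (hp.prodMk (hq.prodMk
    ((hp.add hb).prodMk (hq.sub hb))))).stronglyMeasurable.integral_prod_right'

lemma aestronglyMeasurable_collisionFreq (α : ℝ) {k : E3 → E3 → E3 → E3 → ℝ}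
    (hk : Measurable fun x : E3 × E3 × E3 × E3 => k x.1 x.2.1 x.2.2.1 x.2.2.2)
    {g : E3 → ℝ} (hg : AEStronglyMeasurable g) :
    AEStronglyMeasurable (collisionFreq α k g) := by
  have h1 : AEStronglyMeasurable (fun x : E3 × E3 => α ^ 3 / p0 α x.2)
      ((volume : Measure E3).prod volume) :=
    ((measurable_p0 α measurable_snd).const_div (α ^ 3)).aestronglyMeasurable
  have h2 : AEStronglyMeasurable (fun x : E3 × E3 => g x.2)
      ((volume : Measure E3).prod volume) := hg.comp_snd
  exact (h1.mul (h2.mul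
    (stronglyMeasurable_angularKernel α hk).aestronglyMeasurable)).integral_prod_right'

lemma abs_collisionFreq_le {α : ℝ} (hα : 0 ≤ α) {k : E3 → E3 → E3 → E3 → ℝ} {M : ℝ}
    (hk : ∀ p q p' q', |k p q p' q'| ≤ M) {g : E3 → ℝ} (hg : Integrable g) (p : E3) :
    |collisionFreq α k g p| ≤ 4 * π * M * α ^ 3 * ∫ q : E3, |g q| := by
  rw [← integral_const_mul, ← Real.norm_eq_abs, collisionFreq]
  refine norm_integral_le_of_norm_le (hg.abs.const_mul _)
    (Filter.Eventually.of_forall fun q => ?_)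
  have hq := one_le_p0 α q
  have h1 : |α ^ 3 / p0 α q| ≤ α ^ 3 := by
    rw [abs_of_nonneg (by positivity)]
    exact div_le_self (by positivity) hq
  rw [Real.norm_eq_abs, abs_mul, abs_mul]
  calc |α ^ 3 / p0 α q| * (|g q| * |angularKernel α k p q|)
      ≤ α ^ 3 * (|g q| * (4 * π * M)) := by
        gcongr
        exact abs_angularKernel_le α hk p q
    _ = 4 * π * M * α ^ 3 * |g q| := by ring

lemma abs_Qminus_div_p0_le {α : ℝ} (hα : 0 ≤ α) {k : E3 → E3 → E3 → E3 → ℝ} {M : ℝ}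
    (hk : ∀ p q p' q', |k p q p' q'| ≤ M) (f : E3 → ℝ) {g : E3 → ℝ} (hg : Integrable g) (p : E3) :
    |Qminus α k f g p / p0 α p| ≤ 4 * π * M * α ^ 3 * (∫ q : E3, |g q|) * |f p| := by
  have hp := one_le_p0 α p
  rw [abs_div, abs_of_nonneg (zero_le_one.trans hp), Qminus_eq_mul_collisionFreq, abs_mul,
    mul_comm |f p|]
  exact (div_le_self (by positivity) hp).trans
    (mul_le_mul_of_nonneg_right (abs_collisionFreq_le hα hk hg p) (abs_nonneg _))

lemma integrable_Qminus_div_p0 {α : ℝ} (hα : 0 ≤ α) {k : E3 → E3 → E3 → E3 → ℝ} {M : ℝ}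
    (hkm : Measurable fun x : E3 × E3 × E3 × E3 => k x.1 x.2.1 x.2.2.1 x.2.2.2)
    (hk : ∀ p q p' q', |k p q p' q'| ≤ M) {f g : E3 → ℝ} (hf : Integrable f) (hg : Integrable g) :
    Integrable fun p => Qminus α k f g p / p0 α p := by
  refine (hf.abs.const_mul (4 * π * M * α ^ 3 * ∫ q : E3, |g q|)).mono' ?_
    (Filter.Eventually.of_forall fun p => abs_Qminus_div_p0_le hα hk f hg p)
  simp only [Qminus_eq_mul_collisionFreq, div_eq_mul_inv]
  exact (hf.1.mul (aestronglyMeasurable_collisionFreq α hkm hg.1)).mul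
    (measurable_p0 α measurable_id).inv.aestronglyMeasurable

end RelBoltz

/-- For fixed t ≥ 0 and f, g ∈ L¹(ℝ³), the function (1/p⁰)Q⁻(f,g) belongs to L¹(ℝ³) and
‖(1/p⁰)Q⁻(f,g)‖ ≤ C‖f‖‖g‖ with C = 8πC₁a(0)⁶/C₀³. -/
theorem loss_term_L1_bound
    (a : ℝ → ℝ) (ha : Continuous a) (hapos : ∀ s, 0 ≤ s → 0 < a s)
    (C₀ : ℝ) (hC₀ : 0 < C₀) (haC₀ : ∀ s, 0 ≤ s → C₀ < a s)
    (C₁ : ℝ) (hC₁ : 0 < C₁)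
    (A : ℝ → E3 → E3 → E3 → E3 → ℝ)
    (hAmeas : Measurable fun x : ℝ × E3 × E3 × E3 × E3 =>
      A x.1 x.2.1 x.2.2.1 x.2.2.2.1 x.2.2.2.2)
    (hAnn : ∀ s p q p' q', 0 ≤ A s p q p' q')
    (hAbd : ∀ s p q p' q', A s p q p' q' ≤ C₁)
    (hAsymm : ∀ s p q p' q', A s p q p' q' = A s p' q' p q)
    (t : ℝ) (ht : 0 ≤ t)
    (f g : E3 → ℝ) (hf : Integrable f) (hg : Integrable g) :
    Integrable (fun p => Qminus (a t) (A t) f g p / p0 (a t) p) ∧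
      wnorm (a 0) (a t) (fun p => Qminus (a t) (A t) f g p / p0 (a t) p) ≤
        Cconst C₀ C₁ (a 0) * wnorm (a 0) (a t) f * wnorm (a 0) (a t) g := by
  have hα : 0 < a t := hapos t ht
  have ha0 : 0 < a 0 := hapos 0 le_rfl
  have hk : ∀ p q p' q', |A t p q p' q'| ≤ C₁ := fun p q p' q' => by
    rw [abs_of_nonneg (hAnn ..)]
    exact hAbd ..
  have hkm : Measurable fun x : E3 × E3 × E3 × E3 => A t x.1 x.2.1 x.2.2.1 x.2.2.2 :=
    hAmeas.comp measurable_prodMk_left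
  have hQ := integrable_Qminus_div_p0 hα.le hkm hk hf hg
  refine ⟨hQ, ?_⟩
  have hle : ∫ p, |Qminus (a t) (A t) f g p / p0 (a t) p| ≤
      4 * π * C₁ * a t ^ 3 * (∫ q : E3, |g q|) * ∫ p : E3, |f p| := by
    rw [← integral_const_mul]
    exact integral_mono hQ.abs (hf.abs.const_mul _)
      fun p => abs_Qminus_div_p0_le hα.le hk f hg p
  have hF : 0 ≤ ∫ p : E3, |f p| := integral_nonneg fun p => abs_nonneg _
  have hG : 0 ≤ ∫ q : E3, |g q| := integral_nonneg fun q => abs_nonneg _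
  have hratio : 1 ≤ 2 * (a t ^ 3 / C₀ ^ 3) := by
    have : 1 ≤ a t ^ 3 / C₀ ^ 3 :=
      (one_le_div (by positivity)).2 (pow_le_pow_left₀ hC₀.le (haC₀ t ht).le 3)
    linarith
  unfold wnorm Cconst
  generalize (∫ p : E3, |f p|) = F at *
  generalize (∫ q : E3, |g q|) = G at *
  calc a t ^ 6 / a 0 ^ 6 * ∫ p, |Qminus (a t) (A t) f g p / p0 (a t) p|
      ≤ a t ^ 6 / a 0 ^ 6 * (4 * π * C₁ * a t ^ 3 * G * F) := by gcongr
    _ ≤ a t ^ 6 / a 0 ^ 6 * (4 * π * C₁ * a t ^ 3 * G * F) * (2 * (a t ^ 3 / C₀ ^ 3)) :=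
        le_mul_of_one_le_right (by positivity) hratio
    _ = 8 * π * C₁ * a 0 ^ 6 / C₀ ^ 3 * (a t ^ 6 / a 0 ^ 6 * F) * (a t ^ 6 / a 0 ^ 6 * G) := by
        field_simp
        ring
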